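/- Let n > 2k ≥ 2 and let inv(x) := x/|x|² for x ∈ ℝⁿ∖{0}. Let U ⊆ ℝⁿ∖{0} be open and let φ : U → ℝ be of class C^{2k}. Then for every x ∈ inv(U) (so that inv(x) ∈ U), the conformal transformation law ((−Δ)^k φ)(inv(x)) = |x|^{n+2k} · (−Δ)^k ( y ↦ |y|^{2k−n} φ(inv(y)) )(x) holds, where Δ is the Euclidean Laplacian and (−Δ)^k its k-fold composition. -/

import Mathlib

open Metric Set MeasureTheory Bornology Filter Pointwise

noncomputable section

/-- Euclidean space `ℝⁿ`. -/
abbrev Euc (n : ℕ) : Type := EuclideanSpace ℝ (Fin n)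

/-- A `C^{m,θ}`-smooth bounded domain of `ℝⁿ`, described via a defining function `ρ`
of class `C^m` whose `m`-th derivative is `θ`-Hölder continuous, with nonvanishing
gradient on the boundary. -/
def IsHolderDomain (n m : ℕ) (θ : ℝ) (Ω : Set (Euc n)) : Prop :=
  IsOpen Ω ∧ IsBounded Ω ∧ IsConnected Ω ∧
  ∃ ρ : Euc n → ℝ, ContDiff ℝ m ρ ∧
    (∃ C : ℝ, ∀ x y : Euc n,
      ‖iteratedFDeriv ℝ m ρ x - iteratedFDeriv ℝ m ρ y‖ ≤ C * ‖x - y‖ ^ θ) ∧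
    Ω = {x | ρ x < 0} ∧ frontier Ω = {x | ρ x = 0} ∧
    ∀ x ∈ frontier Ω, fderiv ℝ ρ x ≠ 0

/-- The Euclidean Laplacian `Δ f`. -/
def eucLap {n : ℕ} (f : Euc n → ℝ) (x : Euc n) : ℝ :=
  ∑ i : Fin n, iteratedFDeriv ℝ 2 f x ![EuclideanSpace.single i 1, EuclideanSpace.single i 1]

/-- The polyharmonic operator `(−Δ)^k`. -/
def polyLap {n : ℕ} (k : ℕ) (f : Euc n → ℝ) : Euc n → ℝ :=
  (fun g x => - eucLap g x)^[k] f

/-- `θ`-Hölder continuity on a set. -/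
def HolderOn {n : ℕ} (θ : ℝ) (f : Euc n → ℝ) (s : Set (Euc n)) : Prop :=
  ∃ C : ℝ, ∀ x ∈ s, ∀ y ∈ s, |f x - f y| ≤ C * ‖x - y‖ ^ θ

/-- `u ∈ C^{2k,θ}(D̄)` solves the Dirichlet problem `(−Δ)^k u = f` in `D`,
`u = ∂_ν u = … = ∂_ν^{(k−1)} u = 0` on `∂D` (the boundary conditions being encoded as the
vanishing of all derivatives of order `< k` on the boundary). -/
def IsDirichletSolution {n : ℕ} (k : ℕ) (θ : ℝ) (D : Set (Euc n)) (f u : Euc n → ℝ) : Prop :=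
  ContDiffOn ℝ (2*k) u (closure D) ∧
  (∃ C : ℝ, ∀ x ∈ closure D, ∀ y ∈ closure D,
      ‖iteratedFDerivWithin ℝ (2*k) u (closure D) x -
        iteratedFDerivWithin ℝ (2*k) u (closure D) y‖ ≤ C * ‖x - y‖ ^ θ) ∧
  (∀ x ∈ D, polyLap k u x = f x) ∧
  (∀ i : ℕ, i < k → ∀ x ∈ frontier D, iteratedFDerivWithin ℝ i u (closure D) x = 0)

/-- `G` is the Dirichlet Green function of `(−Δ)^k` on `D`: for every `f ∈ C^{0,θ}(D̄)`,
`x ↦ ∫_D G(x,y) f(y) dy` is the unique solution of the Dirichlet problem. -/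
def IsGreenFunction {n : ℕ} (k : ℕ) (θ : ℝ) (D : Set (Euc n)) (G : Euc n → Euc n → ℝ) : Prop :=
  ∀ f : Euc n → ℝ, ContinuousOn f (closure D) → HolderOn θ f (closure D) →
    IsDirichletSolution k θ D f (fun x => ∫ y in D, G x y * f y) ∧
    ∀ u : Euc n → ℝ, IsDirichletSolution k θ D f u →
      ∀ x ∈ closure D, u x = ∫ y in D, G x y * f y

/-- The inversion at the unit sphere, `inv(x) = x/|x|²`. -/
def invMap {n : ℕ} (x : Euc n) : Euc n := (‖x‖ ^ 2)⁻¹ • x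

/-- `ω₀ := inv(ℝⁿ ∖ ω̄) ∪ {0}`. -/
def omegaZero {n : ℕ} (ω : Set (Euc n)) : Set (Euc n) :=
  (invMap '' (closure ω)ᶜ) ∪ {0}

/-- The exterior Green function
`G_{(εω)^c}(x,y) := ε^{n−2k} |x|^{2k−n} |y|^{2k−n} G₀(ε·inv(x), ε·inv(y))`,
where `G₀` is the Dirichlet Green function of `(−Δ)^k` on `ω₀`. -/
def extGreen {n : ℕ} (k : ℕ) (G₀ : Euc n → Euc n → ℝ) (ε : ℝ) (x y : Euc n) : ℝ :=
  ε ^ ((n : ℝ) - 2*k) * ‖x‖ ^ (2*(k:ℝ) - n) * ‖y‖ ^ (2*(k:ℝ) - n) *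
    G₀ (ε • invMap x) (ε • invMap y)

/-- The partial derivative `∂ᵢ f`. -/
def pderiv {n : ℕ} (i : Fin n) (f : Euc n → ℝ) (x : Euc n) : ℝ :=
  fderiv ℝ f x (EuclideanSpace.single i 1)

/-- The Euler operator `f ↦ x · ∇f`. -/
def euler {n : ℕ} (f : Euc n → ℝ) (x : Euc n) : ℝ := fderiv ℝ f x x

/-- The weighted Kelvin transform `y ↦ |y|^s f(inv y)`. -/
def kelvin {n : ℕ} (s : ℝ) (f : Euc n → ℝ) (y : Euc n) : ℝ := ‖y‖ ^ s * f (invMap y)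

section Calculus

variable {n : ℕ} {f g : Euc n → ℝ} {x : Euc n}

theorem sum_coord_smul_single (x : Euc n) :
    ∑ i, x i • (EuclideanSpace.single i 1 : Euc n) = x := by
  have := (EuclideanSpace.basisFun (Fin n) ℝ).sum_repr x
  simpa using this

theorem euler_eq_sum (f : Euc n → ℝ) (x : Euc n) : euler f x = ∑ i, x i * pderiv i f x := by
  unfold euler pderiv
  conv_lhs => rw [← sum_coord_smul_single x]
  rw [map_sum, sum_coord_smul_single]
  simp

theorem ContDiffAt.pderiv {m : ℕ} (h : ContDiffAt ℝ ((m + 1 : ℕ) : WithTop ℕ∞) f x) (i : Fin n) :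
    ContDiffAt ℝ m (pderiv i f) x := by
  have h1 : ContDiffAt ℝ m (fderiv ℝ f) x := h.fderiv_right (by norm_cast)
  exact h1.clm_apply contDiffAt_const

theorem ContDiffAt.euler {m : ℕ} (h : ContDiffAt ℝ ((m + 1 : ℕ) : WithTop ℕ∞) f x) :
    ContDiffAt ℝ m (euler f) x := by
  have h1 : ContDiffAt ℝ m (fderiv ℝ f) x := h.fderiv_right (by norm_cast)
  exact h1.clm_apply contDiffAt_id

theorem Filter.EventuallyEq.pderiv_eq (h : f =ᶠ[nhds x] g) (i : Fin n) :
    pderiv i f x = pderiv i g x := by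
  unfold pderiv; rw [h.fderiv_eq]

theorem ContDiffAt.eventually_nat {m : ℕ} (h : ContDiffAt ℝ (m : WithTop ℕ∞) f x) :
    ∀ᶠ y in nhds x, ContDiffAt ℝ (m : WithTop ℕ∞) f y :=
  h.eventually (by simp)

theorem ContDiffAt.differentiableAt_of_nat {m : ℕ}
    (h : ContDiffAt ℝ ((m + 1 : ℕ) : WithTop ℕ∞) f x) : DifferentiableAt ℝ f x :=
  h.differentiableAt (by norm_cast)

theorem pderiv_pderiv (h : ContDiffAt ℝ (2 : ℕ) f x) (i j : Fin n) :
    pderiv i (pderiv j f) x = iteratedFDeriv ℝ 2 f x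
      ![EuclideanSpace.single i 1, EuclideanSpace.single j 1] := by
  have h1 : ContDiffAt ℝ (1 : ℕ) (fderiv ℝ f) x := h.fderiv_right (by norm_cast)
  have h2 : DifferentiableAt ℝ (fderiv ℝ f) x := h1.differentiableAt (by norm_num)
  rw [iteratedFDeriv_two_apply]
  unfold pderiv
  rw [fderiv_clm_apply h2 (differentiableAt_const _)]
  simp

theorem pderiv_comm (h : ContDiffAt ℝ (2 : ℕ) f x) (i j : Fin n) :
    pderiv i (pderiv j f) x = pderiv j (pderiv i f) x := by
  rw [pderiv_pderiv h, pderiv_pderiv h, iteratedFDeriv_two_apply, iteratedFDeriv_two_apply]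
  exact (h.isSymmSndFDerivAt (by simp)) _ _

theorem eucLap_eq_sum (h : ContDiffAt ℝ (2 : ℕ) f x) :
    eucLap f x = ∑ i, pderiv i (pderiv i f) x :=
  Finset.sum_congr rfl fun i _ => (pderiv_pderiv h i i).symm

theorem ContDiffAt.eucLap {m : ℕ} (h : ContDiffAt ℝ ((m + 2 : ℕ) : WithTop ℕ∞) f x) :
    ContDiffAt ℝ m (eucLap f) x := by
  have h1 : ContDiffAt ℝ m (fun y => ∑ i, _root_.pderiv i (_root_.pderiv i f) y) x :=
    ContDiffAt.sum fun i _ => ContDiffAt.pderiv (ContDiffAt.pderiv h i) i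
  refine h1.congr_of_eventuallyEq ?_
  filter_upwards [h.eventually_nat] with y hy
  exact eucLap_eq_sum (hy.of_le (by norm_cast; omega))

theorem Filter.EventuallyEq.eucLap_eq (h : f =ᶠ[nhds x] g) : eucLap f x = eucLap g x := by
  unfold eucLap
  rw [(h.iteratedFDeriv ℝ 2).eq_of_nhds]

theorem Filter.EventuallyEq.eucLap (h : f =ᶠ[nhds x] g) :
    _root_.eucLap f =ᶠ[nhds x] _root_.eucLap g :=
  h.eventuallyEq_nhds.mono fun _ hy => hy.eucLap_eq

theorem pderiv_add (hf : DifferentiableAt ℝ f x) (hg : DifferentiableAt ℝ g x) (i : Fin n) :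
    pderiv i (fun y => f y + g y) x = pderiv i f x + pderiv i g x := by
  unfold pderiv; rw [fderiv_fun_add hf hg]; rfl

theorem pderiv_mul (hf : DifferentiableAt ℝ f x) (hg : DifferentiableAt ℝ g x) (i : Fin n) :
    pderiv i (fun y => f y * g y) x = f x * pderiv i g x + g x * pderiv i f x := by
  unfold pderiv; rw [fderiv_fun_mul hf hg]; rfl

theorem pderiv_const_mul (c : ℝ) (hf : DifferentiableAt ℝ f x) (i : Fin n) :
    pderiv i (fun y => c * f y) x = c * pderiv i f x := by
  unfold pderiv; rw [fderiv_const_mul hf]; rfl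

theorem pderiv_sum {ι : Type*} {s : Finset ι} {F : ι → Euc n → ℝ}
    (hF : ∀ j ∈ s, DifferentiableAt ℝ (F j) x) (i : Fin n) :
    pderiv i (fun y => ∑ j ∈ s, F j y) x = ∑ j ∈ s, pderiv i (F j) x := by
  unfold pderiv; rw [fderiv_fun_sum hF]; simp

theorem differentiableAt_coord (j : Fin n) : DifferentiableAt ℝ (fun y : Euc n => y j) x := by
  fun_prop

theorem contDiff_coord (j : Fin n) {m : WithTop ℕ∞} : ContDiff ℝ m (fun y : Euc n => y j) :=
  (EuclideanSpace.proj (𝕜 := ℝ) j).contDiff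

theorem pderiv_coord (i j : Fin n) (x : Euc n) :
    pderiv i (fun y : Euc n => y j) x = if j = i then 1 else 0 := by
  have : HasFDerivAt (fun y : Euc n => y j) (EuclideanSpace.proj (𝕜 := ℝ) j) x :=
    (EuclideanSpace.proj (𝕜 := ℝ) j).hasFDerivAt
  unfold pderiv; rw [this.fderiv]; simp

theorem pderiv_norm_sq (i : Fin n) (x : Euc n) :
    pderiv i (fun y : Euc n => ‖y‖ ^ 2) x = 2 * x i := by
  unfold pderiv
  rw [(hasStrictFDerivAt_norm_sq x).hasFDerivAt.fderiv]
  simp [EuclideanSpace.inner_single_right]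

theorem eucLap_add (hf : ContDiffAt ℝ (2 : ℕ) f x) (hg : ContDiffAt ℝ (2 : ℕ) g x) :
    eucLap (fun y => f y + g y) x = eucLap f x + eucLap g x := by
  unfold eucLap
  have := iteratedFDeriv_add_apply hf hg
  rw [← Finset.sum_add_distrib]
  exact Finset.sum_congr rfl fun i _ => by
    change iteratedFDeriv ℝ 2 (f + g) x _ = _
    rw [this]; rfl

theorem eucLap_const_mul (c : ℝ) (hf : ContDiffAt ℝ (2 : ℕ) f x) :
    eucLap (fun y => c * f y) x = c * eucLap f x := by
  unfold eucLap
  rw [Finset.mul_sum]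
  have := iteratedFDeriv_const_smul_apply (a := c) hf
  exact Finset.sum_congr rfl fun i _ => by
    change iteratedFDeriv ℝ 2 (c • f) x _ = _
    rw [this]; rfl

theorem eucLap_sum {ι : Type*} {s : Finset ι} {F : ι → Euc n → ℝ}
    (hF : ∀ j ∈ s, ContDiffAt ℝ (2 : ℕ) (F j) x) :
    eucLap (fun y => ∑ j ∈ s, F j y) x = ∑ j ∈ s, eucLap (F j) x := by
  unfold eucLap
  rw [iteratedFDeriv_fun_sum_apply hF, Finset.sum_comm]
  simp

theorem eucLap_mul (hf : ContDiffAt ℝ (2 : ℕ) f x) (hg : ContDiffAt ℝ (2 : ℕ) g x) :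
    eucLap (fun y => f y * g y) x =
      f x * eucLap g x + 2 * ∑ i, pderiv i f x * pderiv i g x + g x * eucLap f x := by
  rw [eucLap_eq_sum (hf.mul hg), eucLap_eq_sum hf, eucLap_eq_sum hg, Finset.mul_sum,
    Finset.mul_sum, Finset.mul_sum, ← Finset.sum_add_distrib, ← Finset.sum_add_distrib]
  refine Finset.sum_congr rfl fun i _ => ?_
  have h1 : pderiv i (fun y => f y * g y) =ᶠ[nhds x]
      fun y => f y * pderiv i g y + g y * pderiv i f y := by
    filter_upwards [hf.eventually_nat, hg.eventually_nat] with y h1 h2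
    exact pderiv_mul h1.differentiableAt_of_nat h2.differentiableAt_of_nat i
  have hf0 := hf.differentiableAt_of_nat
  have hg0 := hg.differentiableAt_of_nat
  have hf1 : DifferentiableAt ℝ (pderiv i f) x :=
    ContDiffAt.differentiableAt_of_nat (m := 0) (hf.pderiv i)
  have hg1 : DifferentiableAt ℝ (pderiv i g) x :=
    ContDiffAt.differentiableAt_of_nat (m := 0) (hg.pderiv i)
  rw [h1.pderiv_eq, pderiv_add (hf0.fun_mul hg1) (hg0.fun_mul hf1), pderiv_mul hf0 hg1,
    pderiv_mul hg0 hf1]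
  ring

theorem eucLap_norm_sq (x : Euc n) : eucLap (fun y : Euc n => ‖y‖ ^ 2) x = 2 * n := by
  rw [eucLap_eq_sum (contDiff_norm_sq ℝ).contDiffAt]
  have h (i : Fin n) : pderiv i (fun y : Euc n => ‖y‖ ^ 2) = fun y => 2 * y i :=
    funext fun y => pderiv_norm_sq i y
  simp_rw [h]
  simp [pderiv_const_mul, differentiableAt_coord, pderiv_coord, mul_comm]

theorem eucLap_coord (j : Fin n) (x : Euc n) : eucLap (fun y : Euc n => y j) x = 0 := by
  rw [eucLap_eq_sum (contDiff_coord j).contDiffAt]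
  have h (i : Fin n) : pderiv i (fun y : Euc n => y j) = fun _ => if j = i then 1 else 0 :=
    funext fun y => pderiv_coord i j y
  simp_rw [h]
  simp [pderiv]

theorem eucLap_norm_sq_mul (hf : ContDiffAt ℝ (2 : ℕ) f x) :
    eucLap (fun y => ‖y‖ ^ 2 * f y) x = ‖x‖ ^ 2 * eucLap f x + 4 * euler f x + 2 * n * f x := by
  rw [eucLap_mul (contDiff_norm_sq ℝ).contDiffAt hf, eucLap_norm_sq, euler_eq_sum]
  simp_rw [pderiv_norm_sq, mul_assoc, ← Finset.mul_sum]
  ring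

theorem eucLap_pderiv (hf : ContDiffAt ℝ (3 : ℕ) f x) (j : Fin n) :
    eucLap (pderiv j f) x = pderiv j (eucLap f) x := by
  have h2 : ∀ᶠ y in nhds x, ContDiffAt ℝ (2 : ℕ) f y :=
    hf.eventually_nat.mono fun y hy => hy.of_le (by norm_cast)
  have hL : eucLap f =ᶠ[nhds x] fun y => ∑ i, pderiv i (pderiv i f) y :=
    h2.mono fun y hy => eucLap_eq_sum hy
  have hp (i : Fin n) : ContDiffAt ℝ (2 : ℕ) (pderiv i f) x := hf.pderiv i
  rw [eucLap_eq_sum (hp j), hL.pderiv_eq, pderiv_sum]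
  · refine Finset.sum_congr rfl fun i _ => ?_
    have hc : pderiv i (pderiv j f) =ᶠ[nhds x] pderiv j (pderiv i f) :=
      h2.mono fun y hy => pderiv_comm hy i j
    rw [hc.pderiv_eq, pderiv_comm (hp i)]
  · exact fun i _ => ContDiffAt.differentiableAt_of_nat (m := 0) ((hp i).pderiv i)

theorem eucLap_euler (hf : ContDiffAt ℝ (3 : ℕ) f x) :
    eucLap (euler f) x = euler (eucLap f) x + 2 * eucLap f x := by
  have hE : euler f = fun y => ∑ j, y j * pderiv j f y := funext fun y => euler_eq_sum f y
  have hp (i : Fin n) : ContDiffAt ℝ (2 : ℕ) (pderiv i f) x := hf.pderiv i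
  rw [hE, eucLap_sum fun j _ => (contDiff_coord j).contDiffAt.mul (hp j), euler_eq_sum,
    eucLap_eq_sum (f := f) (hf.of_le (by norm_cast)), Finset.mul_sum, ← Finset.sum_add_distrib]
  refine Finset.sum_congr rfl fun j _ => ?_
  rw [eucLap_mul (contDiff_coord j).contDiffAt (hp j), eucLap_coord, eucLap_pderiv hf]
  simp [pderiv_coord]

theorem euler_neg (f : Euc n → ℝ) (x : Euc n) : euler (fun y => -f y) x = -euler f x := by
  unfold euler; rw [fderiv_fun_neg]; rfl

theorem euler_sub (hf : DifferentiableAt ℝ f x) (hg : DifferentiableAt ℝ g x) :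
    euler (fun y => f y - g y) x = euler f x - euler g x := by
  unfold euler; rw [fderiv_fun_sub hf hg]; rfl

theorem euler_const_mul (c : ℝ) (hf : DifferentiableAt ℝ f x) :
    euler (fun y => c * f y) x = c * euler f x := by
  unfold euler; rw [fderiv_const_mul hf]; rfl

theorem pderiv_sub (hf : DifferentiableAt ℝ f x) (hg : DifferentiableAt ℝ g x) (i : Fin n) :
    pderiv i (fun y => f y - g y) x = pderiv i f x - pderiv i g x := by
  unfold pderiv; rw [fderiv_fun_sub hf hg]; rfl

theorem sum_coord_mul_euler_pderiv (hf : ContDiffAt ℝ (2 : ℕ) f x) :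
    ∑ i, x i * euler (pderiv i f) x = euler (euler f) x - euler f x := by
  have hE : euler f = fun y => ∑ j, y j * pderiv j f y := funext fun y => euler_eq_sum f y
  have hp (i : Fin n) : DifferentiableAt ℝ (pderiv i f) x :=
    ContDiffAt.differentiableAt_of_nat (m := 0) (hf.pderiv i)
  have h1 : euler (euler f) x = ∑ i, (x i * euler (pderiv i f) x + pderiv i f x * x i) := by
    conv_lhs => rw [hE]
    unfold euler
    rw [fderiv_fun_sum fun j _ => (differentiableAt_coord j).fun_mul (hp j), _root_.sum_apply]
    refine Finset.sum_congr rfl fun j _ => ?_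
    have hc : HasFDerivAt (fun y : Euc n => y j) (EuclideanSpace.proj (𝕜 := ℝ) j) x :=
      (EuclideanSpace.proj (𝕜 := ℝ) j).hasFDerivAt
    rw [fderiv_fun_mul (differentiableAt_coord j) (hp j), hc.fderiv]
    simp
  rw [h1, Finset.sum_add_distrib, euler_eq_sum f x]
  simp_rw [mul_comm (pderiv _ f x)]
  ring

end Calculus

section Kelvin

variable {n : ℕ} {f : Euc n → ℝ} {x : Euc n}

theorem norm_rpow_sub_two (hx : x ≠ 0) (s : ℝ) : ‖x‖ ^ (s - 2) = ‖x‖ ^ s * (‖x‖ ^ 2)⁻¹ := by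
  rw [Real.rpow_sub (norm_pos_iff.2 hx), div_eq_mul_inv]
  norm_cast

theorem hasFDerivAt_norm_rpow_of_ne_zero (hx : x ≠ 0) (s : ℝ) :
    HasFDerivAt (fun y : Euc n => ‖y‖ ^ s) ((s * ‖x‖ ^ (s - 2)) • innerSL ℝ x) x := by
  have h0 : ‖x‖ ^ 2 ≠ 0 := by positivity
  have h (y : Euc n) (t : ℝ) : (‖y‖ ^ 2) ^ t = ‖y‖ ^ (2 * t) := by
    rw [Real.rpow_mul (norm_nonneg y)]; norm_cast
  have h1 := (hasStrictFDerivAt_norm_sq x).hasFDerivAt.rpow_const (p := s / 2) (Or.inl h0)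
  simp_rw [h] at h1
  convert! h1 using 1
  · ext y; congr 1; ring
  · rw [← Nat.cast_smul_eq_nsmul ℝ, smul_smul]
    congr 1
    rw [show 2 * (s / 2 - 1) = s - 2 by ring]
    push_cast; ring

theorem hasFDerivAt_invMap (hx : x ≠ 0) :
    HasFDerivAt (invMap (n := n))
      ((‖x‖ ^ 2)⁻¹ • ContinuousLinearMap.id ℝ (Euc n) -
        ((2 * ((‖x‖ ^ 2)⁻¹) ^ 2) • innerSL ℝ x).smulRight x) x := by
  have h0 : ‖x‖ ^ 2 ≠ 0 := by positivity
  have h1 := (hasDerivAt_inv h0).comp_hasFDerivAt x (hasStrictFDerivAt_norm_sq x).hasFDerivAt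
  have h2 := h1.smul (hasFDerivAt_id x)
  convert! h2 using 1
  ext v i
  simp
  ring

theorem contDiffAt_invMap (hx : x ≠ 0) {m : WithTop ℕ∞} : ContDiffAt ℝ m (invMap (n := n)) x :=
  ((contDiff_norm_sq ℝ).contDiffAt.inv (by positivity)).smul contDiffAt_id

theorem invMap_apply (x : Euc n) (i : Fin n) : invMap x i = (‖x‖ ^ 2)⁻¹ * x i := by
  simp [invMap]

theorem norm_invMap_sq (x : Euc n) : ‖invMap x‖ ^ 2 = (‖x‖ ^ 2)⁻¹ := by
  rcases eq_or_ne x 0 with rfl | hx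
  · simp [invMap]
  · have : ‖x‖ ≠ 0 := norm_ne_zero_iff.2 hx
    rw [invMap, norm_smul, norm_inv, norm_pow, norm_norm]
    field_simp

theorem kelvin_differentiableAt (hx : x ≠ 0) (s : ℝ) (hf : DifferentiableAt ℝ f (invMap x)) :
    DifferentiableAt ℝ (kelvin s f) x :=
  (hasFDerivAt_norm_rpow_of_ne_zero hx s).differentiableAt.fun_mul
    (hf.comp x (hasFDerivAt_invMap hx).differentiableAt)

theorem pderiv_kelvin (hx : x ≠ 0) (s : ℝ) (hf : DifferentiableAt ℝ f (invMap x)) (i : Fin n) :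
    pderiv i (kelvin s f) x = kelvin (s - 2) (pderiv i f) x +
      x i * kelvin (s - 2) (fun z => s * f z - 2 * euler f z) x := by
  have h1 := (hasFDerivAt_norm_rpow_of_ne_zero hx s).mul
    (hf.hasFDerivAt.comp x (hasFDerivAt_invMap hx))
  have hE : euler f (invMap x) = (‖x‖ ^ 2)⁻¹ * fderiv ℝ f (invMap x) x := by
    unfold euler
    conv_lhs => rw [show fderiv ℝ f (invMap x) (invMap x) =
      fderiv ℝ f (invMap x) ((‖x‖ ^ 2)⁻¹ • x) from rfl]
    rw [map_smul, smul_eq_mul]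
  change fderiv ℝ ((fun y => ‖y‖ ^ s) * f ∘ invMap) x _ = _
  rw [h1.fderiv]
  simp only [kelvin, hE, pderiv, norm_rpow_sub_two hx]
  simp [EuclideanSpace.inner_single_right]
  ring

theorem eucLap_kelvin (hx : x ≠ 0) (s : ℝ) (hf : ContDiffAt ℝ (2 : ℕ) f (invMap x)) :
    eucLap (kelvin s f) x = kelvin (s - 4) (eucLap f) x
      - 2 * (s + n - 2) * kelvin (s - 2) (euler f) x
      + s * (s + n - 2) * kelvin (s - 2) f x := by
  have hk : ContDiffAt ℝ (2 : ℕ) (kelvin s f) x :=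
    ((contDiffAt_norm ℝ hx).rpow_const_of_ne (norm_ne_zero_iff.2 hx)).mul
      (hf.comp x (contDiffAt_invMap hx))
  have hf0 : DifferentiableAt ℝ f (invMap x) := hf.differentiableAt_of_nat
  have hf1 (i : Fin n) : DifferentiableAt ℝ (pderiv i f) (invMap x) :=
    ContDiffAt.differentiableAt_of_nat (m := 0) (hf.pderiv i)
  have hE : DifferentiableAt ℝ (euler f) (invMap x) :=
    ContDiffAt.differentiableAt_of_nat (m := 0) hf.euler
  set ψ : Euc n → ℝ := fun z => s * f z - 2 * euler f z with hψ
  have hψd : DifferentiableAt ℝ ψ (invMap x) := (hf0.const_mul s).fun_sub (hE.const_mul 2)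
  have hψE : euler ψ (invMap x) = s * euler f (invMap x) - 2 * euler (euler f) (invMap x) := by
    rw [hψ, euler_sub (hf0.const_mul s) (hE.const_mul 2), euler_const_mul s hf0,
      euler_const_mul 2 hE]
  have hψp (i : Fin n) : pderiv i ψ (invMap x) =
      s * pderiv i f (invMap x) - 2 * pderiv i (euler f) (invMap x) := by
    rw [hψ, pderiv_sub (hf0.const_mul s) (hE.const_mul 2), pderiv_const_mul s hf0,
      pderiv_const_mul 2 hE]
  have hev (i : Fin n) : pderiv i (kelvin s f) =ᶠ[nhds x]
      fun y => kelvin (s - 2) (pderiv i f) y + y i * kelvin (s - 2) ψ y := by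
    filter_upwards [(contDiffAt_invMap hx (m := 0)).continuousAt.eventually hf.eventually_nat,
      isOpen_ne.mem_nhds hx] with y hy hy0
    exact pderiv_kelvin hy0 s hy.differentiableAt_of_nat i
  have h0 : ‖x‖ ^ 2 ≠ 0 := by positivity
  have hc (i : Fin n) : x i = ‖x‖ ^ 2 * invMap x i := by
    rw [invMap_apply]; field_simp
  have hsq : ∑ i, x i ^ 2 = ‖x‖ ^ 2 := (EuclideanSpace.real_norm_sq_eq x).symm
  have hterm (i : Fin n) : pderiv i (pderiv i (kelvin s f)) x =
      ‖x‖ ^ (s - 4) * (pderiv i (pderiv i f) (invMap x) + ‖x‖ ^ 2 * ψ (invMap x)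
        + ‖x‖ ^ 2 * ((2 * s - 2) * (invMap x i * pderiv i f (invMap x))
          - 2 * (invMap x i * euler (pderiv i f) (invMap x))
          - 2 * (invMap x i * pderiv i (euler f) (invMap x)))
        + x i ^ 2 * ((s - 2) * ψ (invMap x) - 2 * euler ψ (invMap x))) := by
    have hk2 : DifferentiableAt ℝ (kelvin (s - 2) ψ) x := kelvin_differentiableAt hx _ hψd
    rw [(hev i).pderiv_eq, pderiv_add (kelvin_differentiableAt hx _ (hf1 i))
      ((differentiableAt_coord i).fun_mul hk2), pderiv_mul (differentiableAt_coord i) hk2,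
      pderiv_coord, pderiv_kelvin hx _ (hf1 i), pderiv_kelvin hx _ hψd]
    have e2 : ‖x‖ ^ (s - 2) = ‖x‖ ^ (s - 4) * ‖x‖ ^ 2 := by
      rw [show s - 4 = s - 2 - 2 by ring, norm_rpow_sub_two hx (s - 2)]; field_simp
    simp only [kelvin, hψp, e2, show s - 2 - 2 = s - 4 by ring, if_true]
    linear_combination ‖x‖ ^ (s - 4) * ((2 * s - 2) * pderiv i f (invMap x)
      - 2 * euler (pderiv i f) (invMap x) - 2 * pderiv i (euler f) (invMap x)) * hc i
  rw [eucLap_eq_sum hk]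
  simp_rw [hterm]
  rw [← Finset.mul_sum]
  simp only [Finset.sum_add_distrib, Finset.sum_sub_distrib, ← Finset.mul_sum, ← Finset.sum_mul,
    hsq, ← euler_eq_sum, sum_coord_mul_euler_pderiv hf, ← eucLap_eq_sum hf, Finset.sum_const,
    Finset.card_univ, Fintype.card_fin, nsmul_eq_mul, hψE]
  have e2 : ‖x‖ ^ (s - 2) = ‖x‖ ^ (s - 4) * ‖x‖ ^ 2 := by
    rw [show s - 4 = s - 2 - 2 by ring, norm_rpow_sub_two hx (s - 2)]; field_simp
  simp only [kelvin, e2, hψ]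
  ring

end Kelvin

section PolyLap

variable {n : ℕ} {f g : Euc n → ℝ} {x : Euc n}

theorem polyLap_succ (k : ℕ) (f : Euc n → ℝ) :
    polyLap (k + 1) f = polyLap k (fun y => -eucLap f y) := rfl

theorem Filter.EventuallyEq.polyLap_eq (h : f =ᶠ[nhds x] g) (k : ℕ) :
    polyLap k f x = polyLap k g x := by
  induction k generalizing f g with
  | zero => exact h.eq_of_nhds
  | succ k ih => exact ih (h.eucLap.fun_comp Neg.neg)

theorem ContDiffAt.neg_eucLap {m : ℕ} (h : ContDiffAt ℝ ((m + 2 : ℕ) : WithTop ℕ∞) f x) :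
    ContDiffAt ℝ m (fun y => -_root_.eucLap f y) x :=
  h.eucLap.neg

theorem ContDiffAt.eventually_of_le {m l : ℕ} (h : ContDiffAt ℝ (m : WithTop ℕ∞) f x)
    (hl : l ≤ m) : ∀ᶠ y in nhds x, ContDiffAt ℝ (l : WithTop ℕ∞) f y :=
  h.eventually_nat.mono fun _ hy => hy.of_le (by exact_mod_cast hl)

theorem polyLap_add {k : ℕ} (hf : ContDiffAt ℝ (2 * k : ℕ) f x)
    (hg : ContDiffAt ℝ (2 * k : ℕ) g x) :
    polyLap k (fun y => f y + g y) x = polyLap k f x + polyLap k g x := by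
  induction k generalizing f g with
  | zero => rfl
  | succ k ih =>
    rw [polyLap_succ, polyLap_succ, polyLap_succ,
      ← ih (ContDiffAt.neg_eucLap hf) (ContDiffAt.neg_eucLap hg)]
    refine Filter.EventuallyEq.polyLap_eq ?_ k
    filter_upwards [hf.eventually_of_le (l := 2) (by omega),
      hg.eventually_of_le (l := 2) (by omega)] with y h1 h2
    rw [eucLap_add h1 h2]; ring

theorem polyLap_const_mul {k : ℕ} (c : ℝ) (hf : ContDiffAt ℝ (2 * k : ℕ) f x) :
    polyLap k (fun y => c * f y) x = c * polyLap k f x := by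
  induction k generalizing f with
  | zero => rfl
  | succ k ih =>
    rw [polyLap_succ, polyLap_succ, ← ih (ContDiffAt.neg_eucLap hf)]
    refine Filter.EventuallyEq.polyLap_eq ?_ k
    filter_upwards [hf.eventually_of_le (l := 2) (by omega)] with y h1
    rw [eucLap_const_mul c h1]; ring

theorem polyLap_euler {k : ℕ} (hf : ContDiffAt ℝ (2 * k + 1 : ℕ) f x) :
    polyLap k (euler f) x = euler (polyLap k f) x + 2 * k * polyLap k f x := by
  induction k generalizing f with
  | zero => simp [polyLap]
  | succ k ih =>
    have hL : ContDiffAt ℝ (2 * k + 1 : ℕ) (fun y => -eucLap f y) x :=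
      ContDiffAt.neg_eucLap (hf.of_le (by norm_cast))
    have hL0 : ContDiffAt ℝ (2 * k : ℕ) (fun y => -eucLap f y) x :=
      hL.of_le (by norm_cast; omega)
    have h : (fun y => -eucLap (euler f) y) =ᶠ[nhds x]
        fun y => euler (fun z => -eucLap f z) y + 2 * -eucLap f y := by
      filter_upwards [hf.eventually_of_le (l := 3) (by omega)] with y h1
      rw [eucLap_euler h1, euler_neg]; ring
    rw [polyLap_succ, polyLap_succ, h.polyLap_eq, polyLap_add hL.euler (contDiffAt_const.mul hL0),
      polyLap_const_mul 2 hL0, ih hL]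
    push_cast; ring

theorem polyLap_norm_sq_mul_neg_eucLap {k : ℕ} (hf : ContDiffAt ℝ (2 * k + 2 : ℕ) f x) :
    polyLap k (fun y => ‖y‖ ^ 2 * -eucLap f y) x = ‖x‖ ^ 2 * polyLap (k + 1) f x
      - 4 * k * euler (polyLap k f) x - 2 * k * (n + 2 * k - 2) * polyLap k f x := by
  induction k generalizing f with
  | zero => simp [polyLap]
  | succ k ih =>
    have hL : ContDiffAt ℝ (2 * k + 2 : ℕ) (fun y => -eucLap f y) x :=
      ContDiffAt.neg_eucLap (hf.of_le (by norm_cast))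
    have hL1 : ContDiffAt ℝ (2 * k + 1 : ℕ) (fun y => -eucLap f y) x :=
      hL.of_le (by norm_cast; omega)
    have hL0 : ContDiffAt ℝ (2 * k : ℕ) (fun y => -eucLap f y) x :=
      hL.of_le (by norm_cast; omega)
    have h : (fun y => -eucLap (fun y => ‖y‖ ^ 2 * -eucLap f y) y) =ᶠ[nhds x]
        fun y => ‖y‖ ^ 2 * -eucLap (fun z => -eucLap f z) y +
          ((-4) * euler (fun z => -eucLap f z) y + (-2 * n) * -eucLap f y) := by
      filter_upwards [hL.eventually_of_le (l := 2) (by omega)] with y h1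
      rw [eucLap_norm_sq_mul h1]; ring
    rw [polyLap_succ, h.polyLap_eq, polyLap_add
      ((contDiff_norm_sq ℝ).contDiffAt.mul (ContDiffAt.neg_eucLap hL))
      ((contDiffAt_const.mul hL1.euler).add (contDiffAt_const.mul hL0)),
      polyLap_add (contDiffAt_const.mul hL1.euler) (contDiffAt_const.mul hL0),
      polyLap_const_mul _ hL0, polyLap_const_mul _ hL1.euler, ih hL, polyLap_euler hL1]
    simp only [← polyLap_succ]
    push_cast; ring

theorem polyLap_kelvin {k : ℕ} (hx : x ≠ 0) (hf : ContDiffAt ℝ (2 * k : ℕ) f (invMap x)) :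
    polyLap k (kelvin (2 * k - n) f) x = kelvin (-n - 2 * k) (polyLap k f) x := by
  induction k generalizing f with
  | zero => simp [polyLap]
  | succ k ih =>
    have hf' : ContDiffAt ℝ (2 * k + 2 : ℕ) f (invMap x) := hf
    have hL : ContDiffAt ℝ (2 * k : ℕ) (fun y => -eucLap f y) (invMap x) :=
      ContDiffAt.neg_eucLap hf'
    have hf1 : ContDiffAt ℝ (2 * k + 1 : ℕ) f (invMap x) := hf'.of_le (by norm_cast; omega)
    have hf0 : ContDiffAt ℝ (2 * k : ℕ) f (invMap x) := hf'.of_le (by norm_cast; omega)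
    have hNL : ContDiffAt ℝ (2 * k : ℕ) (fun y => ‖y‖ ^ 2 * -eucLap f y) (invMap x) :=
      (contDiff_norm_sq ℝ).contDiffAt.mul hL
    have h : (fun y => -eucLap (kelvin (2 * (k + 1 : ℕ) - n) f) y) =ᶠ[nhds x]
        kelvin (2 * k - n) (fun z => ‖z‖ ^ 2 * -eucLap f z +
          (4 * k * euler f z + (-(2 * k * (2 * k + 2 - n))) * f z)) := by
      filter_upwards [(contDiffAt_invMap hx (m := 0)).continuousAt.eventually
        (hf.eventually_of_le (l := 2) (by omega)), isOpen_ne.mem_nhds hx] with y hy hy0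
      rw [eucLap_kelvin hy0 _ hy]
      simp only [kelvin, norm_invMap_sq]
      push_cast
      rw [show (2 * ((k : ℝ) + 1) - n - 4) = 2 * k - n - 2 by ring, norm_rpow_sub_two hy0,
        show (2 * ((k : ℝ) + 1) - n - 2) = 2 * k - n by ring]
      ring
    rw [polyLap_succ, h.polyLap_eq, ih (hNL.add ((contDiffAt_const.mul hf1.euler).add
      (contDiffAt_const.mul hf0)))]
    simp only [kelvin]
    rw [polyLap_add hNL ((contDiffAt_const.mul hf1.euler).add (contDiffAt_const.mul hf0)),
      polyLap_add (contDiffAt_const.mul hf1.euler) (contDiffAt_const.mul hf0),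
      polyLap_const_mul _ hf1.euler, polyLap_const_mul _ hf0,
      polyLap_norm_sq_mul_neg_eucLap hf', polyLap_euler hf1, norm_invMap_sq]
    push_cast
    rw [show -(n : ℝ) - 2 * (k + 1) = -n - 2 * k - 2 by ring, norm_rpow_sub_two hx]
    ring

end PolyLap

/-- Conformal transformation law of `(−Δ)^k` under the inversion `inv(x) = x/|x|²`:
`((−Δ)^k φ)(inv(x)) = |x|^{n+2k} (−Δ)^k (|·|^{2k−n} φ∘inv)(x)`. -/
theorem polyharmonic_conformal_law
    (n k : ℕ) (hk : 1 ≤ k) (hn : 2*k < n)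
    (U : Set (Euc n)) (hU : IsOpen U) (hU0 : (0 : Euc n) ∉ U)
    (φ : Euc n → ℝ) (hφ : ContDiffOn ℝ (2*k) φ U)
    (x : Euc n) (hx : x ≠ 0) (hxU : invMap x ∈ U) :
    polyLap k φ (invMap x) =
      ‖x‖ ^ ((n:ℝ) + 2*k) *
        polyLap k (fun y => ‖y‖ ^ (2*(k:ℝ) - n) * φ (invMap y)) x := by
  have hφ' : ContDiffAt ℝ (2 * k : ℕ) φ (invMap x) := by
    exact_mod_cast hφ.contDiffAt (hU.mem_nhds hxU)
  have h0 : 0 < ‖x‖ := norm_pos_iff.2 hx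
  change _ = _ * polyLap k (kelvin (2 * k - n) φ) x
  rw [polyLap_kelvin hx hφ', kelvin, ← mul_assoc, ← Real.rpow_add h0,
    show (n : ℝ) + 2 * k + (-n - 2 * k) = 0 by ring, Real.rpow_zero, one_mul]
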